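/- There exists a magma (M, ⋄) satisfying Equation206 but not satisfying Equation1648. (Proved via a translation-invariant model on the non-abelian group generated by a, b, c subject to a² = b² = c² = 1, satisfying the functional equation f(f(h))·f(f(f(h))⁻¹·h) = 1 but not f(h)·f(f(f(h)⁻¹·h)) = 1.) -/

import Mathlib

inductive TT : Type
  | leaf : ℕ → TT
  | mk : TT → TT → TT

namespace TT

def sz : TT → ℕ
  | leaf _ => 0
  | mk p q => sz p + sz q + 1

open Classical in
/-- The operation: idempotent, free apart from forced values and a collision. -/
noncomputable def op : TT → TT → TT
  | leaf n, y => if y = leaf n then leaf n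
      else if n < 2 ∧ y = leaf 2 then leaf 3 else mk (leaf n) y
  | mk p q, y => if y = mk p q then mk p q
      else if p ≠ q ∧ op p y = q then p else mk (mk p q) y

theorem op_self (x : TT) : op x x = x := by
  cases x <;> simp [op]

theorem op_big (u w : TT) : ∀ p q : TT, sz p < sz (mk u w) → sz q < sz (mk u w) →
    op p (mk u w) ≠ q := by
  intro p
  induction p with
  | leaf n =>
    intro q _ hq h
    simp [op] at h
    subst h
    simp [sz] at hq
  | mk r s ihr _ =>
    intro q hp hq h
    have hr : sz r < sz (mk u w) := by simp only [sz] at hp ⊢; omega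
    have hs : sz s < sz (mk u w) := by simp only [sz] at hp ⊢; omega
    have h1 := ihr s hr hs
    have h2 : mk u w ≠ mk r s := by
      intro e
      rw [e] at hp
      exact lt_irrefl _ hp
    rw [op, if_neg h2, if_neg (fun e => h1 e.2)] at h
    subst h
    simp only [sz] at hq
    omega

theorem fresh (x y v : TT) (h : op x y = v) (hv : x ≠ v) : op (mk x v) y = x := by
  have h2 : y ≠ mk x v := by
    rintro rfl
    exact op_big x v x v (by simp only [sz]; omega) (by simp only [sz]; omega) h
  rw [op, if_neg h2, if_pos ⟨hv, h⟩]

theorem eq206 (x y : TT) : op (op x (op x y)) y = x := by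
  by_cases hxy : op x y = x
  · rw [hxy, op_self, hxy]
  have hy : y ≠ x := by
    rintro rfl
    exact hxy (op_self _)
  obtain ⟨v, hv⟩ : ∃ v, op x y = v := ⟨_, rfl⟩
  rw [hv] at hxy ⊢
  suffices h : op x v = mk x v by
    rw [h]
    exact fresh x y v hv (Ne.symm hxy)
  cases x with
  | leaf n =>
    have h2 : v ≠ leaf 2 := by
      rintro rfl
      rw [op, if_neg hy] at hv
      split_ifs at hv
      simp at hv
    rw [op, if_neg hxy, if_neg (fun e => h2 e.2)]
  | mk p q =>
    rw [op, if_neg hxy, if_neg]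
    rintro ⟨hpq, h⟩
    rw [op, if_neg hy] at hv
    split_ifs at hv with h3
    · subst hv
      rw [op_self] at h
      exact hpq h
    · subst hv
      exact op_big _ _ p q (by simp only [sz]; omega) (by simp only [sz]; omega) h

end TT

/-- There exists a magma satisfying Equation206
(`∀ x y, x = (x ⋄ (x ⋄ y)) ⋄ y`) but not Equation1648
(`∀ x y, x = (x ⋄ y) ⋄ ((x ⋄ y) ⋄ y)`). -/
theorem Equation206_not_implies_Equation1648 :
    ∃ (M : Type) (op : M → M → M),
      (∀ x y : M, x = op (op x (op x y)) y) ∧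
      ¬ (∀ x y : M, x = op (op x y) (op (op x y) y)) := by
  refine ⟨TT, TT.op, fun x y => (TT.eq206 x y).symm, fun h => ?_⟩
  have h0 := h (.leaf 0) (.leaf 2)
  have h1 := h (.leaf 1) (.leaf 2)
  have e0 : TT.op (.leaf 0) (.leaf 2) = .leaf 3 := by simp [TT.op]
  have e1 : TT.op (.leaf 1) (.leaf 2) = .leaf 3 := by simp [TT.op]
  rw [e0] at h0
  rw [e1, ← h0] at h1
  simp at h1
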